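/- Let h = 2n+1 be an odd integer with n ≥ 1, let τ be an h-bar-core, and let λ ∈ P_{τ,2} with ∂λ = 0. If λ has a 2h-bar, i.e. b(λ) = a(λ) + h or a(λ) + b(λ) = 2h, then a(λ) ≥ h. -/

import Mathlib

/-- A partition: a weakly decreasing sequence of non-negative integers with
finite sum (finitely many nonzero parts), indexed from 0 (so `parts 0` is λ₁). -/
structure BPartition where
  parts : ℕ →₀ ℕ
  antitone : ∀ r, parts (r + 1) ≤ parts r

namespace BPartition

/-- The multiset of positive parts of a partition. -/
def partsM (lam : BPartition) : Multiset ℕ :=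
  lam.parts.support.val.map (fun r => lam.parts r)

/-- The Young diagram: nodes `(r, c)` with rows indexed from 0 and columns from 1. -/
def diagram (lam : BPartition) : Set (ℕ × ℕ) :=
  {x | 1 ≤ x.2 ∧ x.2 ≤ lam.parts x.1}

/-- A partition is strict if λ_r > λ_{r+1} whenever λ_r > 0. -/
def IsStrict (lam : BPartition) : Prop :=
  ∀ r, 0 < lam.parts r → lam.parts (r + 1) < lam.parts r

/-- A partition is h-strict if each part is either strictly bigger than the next,
or positive and divisible by h, or zero. -/
def IsHStrict (h : ℕ) (lam : BPartition) : Prop :=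
  ∀ r, lam.parts (r + 1) < lam.parts r ∨ (0 < lam.parts r ∧ h ∣ lam.parts r) ∨ lam.parts r = 0

/-- An h-strict partition is restricted if for every r either λ_{r+1} > λ_r − h,
or λ_{r+1} = λ_r − h and h does not divide λ_r. -/
def IsRestricted (h : ℕ) (lam : BPartition) : Prop :=
  ∀ r, lam.parts r < lam.parts (r + 1) + h ∨
    (lam.parts (r + 1) + h = lam.parts r ∧ ¬ h ∣ lam.parts r)

/-- The residue of a node in column c (1-indexed): the smaller of the residues of
c − 1 and of −c modulo h. -/
def colRes (h c : ℕ) : ℕ := min ((c - 1) % h) ((h - c % h) % h)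

/-- `x` is an addable i-node of `lam`. -/
def Addable (h i : ℕ) (lam : BPartition) (x : ℕ × ℕ) : Prop :=
  colRes h x.2 = i ∧ x ∉ diagram lam ∧
  ∃ nu : BPartition, IsHStrict h nu ∧ diagram lam ⊆ diagram nu ∧ x ∈ diagram nu ∧
    ∀ y ∈ diagram nu, y ∉ diagram lam → colRes h y.2 = i

/-- `x` is a removable i-node of `lam`. -/
def Removable (h i : ℕ) (lam : BPartition) (x : ℕ × ℕ) : Prop :=
  x ∈ diagram lam ∧
  ∃ mu : BPartition, IsHStrict h mu ∧ diagram mu ⊆ diagram lam ∧ x ∉ diagram mu ∧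
    ∀ y ∈ diagram lam, y ∉ diagram mu → colRes h y.2 = i

/-- Removal of a single h-bar from `lam` giving `mu`, recording the value `v`:
either a part `v ≥ h` is replaced by `v − h` (deleted if `v = h`), or two parts
summing to `h` are deleted, in which case `v` is the larger of the two. -/
def barStepRec (h : ℕ) (lam mu : BPartition) (v : ℕ) : Prop :=
  IsHStrict h mu ∧
  ((v = h ∧ v ∈ partsM lam ∧ partsM mu = (partsM lam).erase v) ∨
   (h < v ∧ v ∈ partsM lam ∧ partsM mu = (v - h) ::ₘ (partsM lam).erase v) ∨
   (∃ a b : ℕ, a + b = h ∧ a ∈ partsM lam ∧ b ∈ (partsM lam).erase a ∧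
      v = max a b ∧ partsM mu = ((partsM lam).erase a).erase b))

/-- Removal of a single h-bar. -/
def barStep (h : ℕ) (lam mu : BPartition) : Prop :=
  ∃ v, barStepRec h lam mu v

/-- An h-bar-core: an h-strict partition from which no h-bar can be removed. -/
def IsBarCore (h : ℕ) (lam : BPartition) : Prop :=
  IsHStrict h lam ∧ ∀ mu, ¬ barStep h lam mu

/-- A chain of `w` h-bar removals from `lam` down to `mu`. -/
def barChain (h : ℕ) : ℕ → BPartition → BPartition → Prop
  | 0, lam, mu => lam = mu
  | w + 1, lam, mu => ∃ nu, barStep h lam nu ∧ barChain h w nu mu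

/-- `lam ∈ P_{τ,w}`: `lam` is h-strict with h-bar-core `tau` and h-bar-weight `w`. -/
def InBlock (h : ℕ) (tau : BPartition) (w : ℕ) (lam : BPartition) : Prop :=
  IsHStrict h lam ∧ IsBarCore h tau ∧ barChain h w lam tau

/-- The left-to-right order on node positions along the edge of a Young diagram:
smaller column first; within a column, larger row first. -/
def posLE (x y : ℕ × ℕ) : Prop := x.2 < y.2 ∨ (x.2 = y.2 ∧ y.1 ≤ x.1)

/-- `x` is a normal i-node: a removable i-node surviving (as a − sign) in the
reduced i-signature; equivalently, every window of the i-signature ending at `x`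
contains strictly more removable than addable i-nodes. -/
def Normal (h i : ℕ) (lam : BPartition) (x : ℕ × ℕ) : Prop :=
  Removable h i lam x ∧ ∀ z : ℕ × ℕ, posLE z x →
    Set.ncard {y | Addable h i lam y ∧ posLE z y ∧ posLE y x} <
      Set.ncard {y | Removable h i lam y ∧ posLE z y ∧ posLE y x}

/-- `x` is a conormal i-node: an addable i-node surviving (as a + sign) in the
reduced i-signature. -/
def Conormal (h i : ℕ) (lam : BPartition) (x : ℕ × ℕ) : Prop :=
  Addable h i lam x ∧ ∀ z : ℕ × ℕ, posLE x z →
    Set.ncard {y | Removable h i lam y ∧ posLE x y ∧ posLE y z} <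
      Set.ncard {y | Addable h i lam y ∧ posLE x y ∧ posLE y z}

/-- The node set of ψ_i(λ): add the leftmost s − r conormal i-nodes if s ≥ r,
remove the rightmost r − s normal i-nodes if r > s, where r = #normal and
s = #conormal i-nodes. -/
noncomputable def psiSet (h i : ℕ) (lam : BPartition) : Set (ℕ × ℕ) :=
  if Set.ncard {x | Normal h i lam x} ≤ Set.ncard {x | Conormal h i lam x} then
    diagram lam ∪ {x | Conormal h i lam x ∧
      Set.ncard {y | Conormal h i lam y ∧ posLE y x} ≤
        Set.ncard {x | Conormal h i lam x} - Set.ncard {x | Normal h i lam x}}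
  else
    diagram lam \ {x | Normal h i lam x ∧
      Set.ncard {y | Normal h i lam y ∧ posLE x y} ≤
        Set.ncard {x | Normal h i lam x} - Set.ncard {x | Conormal h i lam x}}

open Classical in
/-- The involution ψ_i. -/
noncomputable def psi (h i : ℕ) (lam : BPartition) : BPartition :=
  if hex : ∃ mu : BPartition, diagram mu = psiSet h i lam then hex.choose else lam

/-- The set of occupied positions of the abacus display of a strict partition. -/
def abacus (lam : BPartition) : Set ℤ :=
  {a | a = 0 ∨ (0 < a ∧ a.toNat ∈ partsM lam) ∨ (a < 0 ∧ (-a).toNat ∉ partsM lam)}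

/-- The dominance order: λ ⊴ μ. -/
def domLE (lam mu : BPartition) : Prop :=
  ∀ r, ∑ s ∈ Finset.range r, lam.parts s ≤ ∑ s ∈ Finset.range r, mu.parts s

/-- Strict dominance: λ ◁ μ. -/
def domLT (lam mu : BPartition) : Prop := domLE lam mu ∧ lam ≠ mu

/-- Lexicographic order: λ <lex μ. -/
def lexLT (lam mu : BPartition) : Prop :=
  ∃ r, lam.parts r < mu.parts r ∧ ∀ s < r, lam.parts s = mu.parts s

/-- Colexicographic order: λ <colex μ. -/
def colexLT (lam mu : BPartition) : Prop :=
  ∃ r, mu.parts r < lam.parts r ∧ ∀ s, r < s → lam.parts s = mu.parts s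

/-- λ ↔ᵢ μ: every node of the symmetric difference of the diagrams has residue i. -/
def Link (h i : ℕ) (lam mu : BPartition) : Prop :=
  ∀ x : ℕ × ℕ, x ∈ (diagram lam \ diagram mu) ∪ (diagram mu \ diagram lam) →
    colRes h x.2 = i

/-- `a ≤ b` are the bar positions of `lam ∈ P_{τ,2}`: the values recorded by
some two-step removal of h-bars from `lam` down to `tau`. -/
def BarPositions (h : ℕ) (tau lam : BPartition) (a b : ℕ) : Prop :=
  a ≤ b ∧ ∃ (nu : BPartition) (v₁ v₂ : ℕ), barStepRec h lam nu v₁ ∧ barStepRec h nu tau v₂ ∧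
    ({a, b} : Multiset ℕ) = {v₁, v₂}

/-- The leg length of the bar of `lam ∈ P_{τ,2}` at bar position `c`. -/
noncomputable def legLen (h : ℕ) (tau lam : BPartition) (c : ℕ) : ℕ :=
  if h ≤ c then Set.ncard {x : ℕ | c - h < x ∧ x < c ∧ x ∈ partsM lam ∧ x ∈ partsM tau}
  else (h - c) + Set.ncard {x : ℕ | h - c < x ∧ x < c ∧ x ∈ partsM lam ∧ x ∈ partsM tau}

/-- ∂λ: the absolute difference of the two leg lengths of `lam`, whose bar
positions are `a ≤ b`. -/
noncomputable def ddd (h : ℕ) (tau lam : BPartition) (a b : ℕ) : ℕ :=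
  max (legLen h tau lam a) (legLen h tau lam b) - min (legLen h tau lam a) (legLen h tau lam b)

inductive Colour | black | white | grey
deriving DecidableEq

/-- β(τ): the number of parts of τ less than h. -/
def betaCount (h : ℕ) (tau : BPartition) : ℕ :=
  Multiset.card ((partsM tau).filter (fun x => x < h))

/-- The leg length of a 2h-bar of `lam` with larger bar position `b`. -/
noncomputable def legLen2 (h : ℕ) (tau lam : BPartition) (b : ℕ) : ℕ :=
  if 2 * h ≤ b then Set.ncard {x : ℕ | b - 2 * h < x ∧ x < b ∧ x ∈ partsM lam ∧ x ∈ partsM tau}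
  else (2 * h - b) + Set.ncard {x : ℕ | 2 * h - b < x ∧ x < b ∧ x ∈ partsM lam ∧ x ∈ partsM tau}

/-- The colour of `lam ∈ P_{τ,2}` with bar positions `a ≤ b`. -/
noncomputable def colour (h : ℕ) (tau lam : BPartition) (a b : ℕ) : Colour :=
  if 2 ≤ ddd h tau lam a b then Colour.grey
  else if ddd h tau lam a b = 1 then
    if h < b then Colour.grey
    else if (min (legLen h tau lam a) (legLen h tau lam b) + betaCount h tau) % 2 = 1 then
      Colour.black else Colour.white
  else
    if b = a + h ∨ a + b = 2 * h then
      if (legLen2 h tau lam b + 2 * betaCount h tau) % 4 = 0 ∨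
         (legLen2 h tau lam b + 2 * betaCount h tau) % 4 = 3 then Colour.black
      else Colour.white
    else
      if (legLen h tau lam a + betaCount h tau) % 2 = 1 then Colour.black else Colour.white

end BPartition

open BPartition in
theorem aux_zero (lam : BPartition) : 0 ∉ partsM lam := by
  simp [partsM]

open BPartition in
theorem aux_anti (lam : BPartition) : Antitone (fun r => lam.parts r) :=
  antitone_nat_of_succ_le lam.antitone

open BPartition in
theorem aux_count (h : ℕ) (lam : BPartition) (hs : IsHStrict h lam) (x : ℕ)
    (hx : ¬ h ∣ x) : (partsM lam).count x ≤ 1 := by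
  by_contra hc
  push Not at hc
  unfold partsM at hc
  rw [Multiset.count_map] at hc
  have hc' : 1 < (lam.parts.support.filter (fun r => x = lam.parts r)).card := hc
  rw [Finset.one_lt_card] at hc'
  obtain ⟨r, hr, s, hs', hne⟩ := hc'
  simp only [Finset.mem_filter, Finsupp.mem_support_iff] at hr hs'
  have key : ∀ r s, r < s → x = lam.parts r → x = lam.parts s → lam.parts r ≠ 0 → False := by
    intro r s hlt h1 h2 h0
    have h3 : lam.parts s ≤ lam.parts (r+1) := aux_anti lam hlt
    have h4 := lam.antitone r
    rcases hs r with h5 | ⟨_, h5⟩ | h5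
    · omega
    · exact hx (h1 ▸ h5)
    · exact h0 h5
  rcases lt_or_gt_of_ne hne with hl | hl
  · exact key r s hl hr.2 hs'.2 hr.1
  · exact key s r hl hs'.2 hr.2 hs'.1

open BPartition in
theorem aux_exists (h : ℕ) (M : Multiset ℕ) (h0 : 0 ∉ M)
    (hM : ∀ x, ¬ h ∣ x → M.count x ≤ 1) :
    ∃ mu : BPartition, IsHStrict h mu ∧ partsM mu = M := by
  obtain ⟨l, hl, hsort⟩ : ∃ l : List ℕ, (l : Multiset ℕ) = M ∧ l.Pairwise (· ≥ ·) :=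
    ⟨M.sort (· ≥ ·), Multiset.sort_eq _ _, Multiset.pairwise_sort _ _⟩
  have hpos : ∀ r (hr : r < l.length), l[r] ≠ 0 := by
    intro r hr h
    apply h0
    rw [← hl, ← h]
    simp
  have hsupp : ∀ r, r ∈ Finset.range l.length ↔ l.getD r 0 ≠ 0 := by
    intro r
    rw [Finset.mem_range]
    constructor
    · intro hr
      rw [List.getD_eq_getElem _ _ hr]
      exact hpos r hr
    · intro hr
      by_contra hc
      exact hr (List.getD_eq_default _ _ (by omega))
  let p : ℕ →₀ ℕ := ⟨Finset.range l.length, fun r => l.getD r 0, hsupp⟩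
  have hp : ∀ r, p r = l.getD r 0 := fun r => rfl
  have hanti : ∀ r, p (r+1) ≤ p r := by
    intro r
    rw [hp, hp]
    by_cases hr : r + 1 < l.length
    · rw [List.getD_eq_getElem _ _ hr, List.getD_eq_getElem _ _ (by omega : r < l.length)]
      exact (List.pairwise_iff_getElem.1 hsort) r (r+1) (by omega) hr (by omega)
    · rw [List.getD_eq_default _ _ (by omega)]
      exact Nat.zero_le _
  refine ⟨⟨p, hanti⟩, ?_, ?_⟩
  · intro r
    show p (r+1) < p r ∨ (0 < p r ∧ h ∣ p r) ∨ p r = 0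
    by_cases hz : p r = 0
    · exact Or.inr (Or.inr hz)
    by_cases hlt : p (r+1) < p r
    · exact Or.inl hlt
    have heq : p (r+1) = p r := le_antisymm (hanti r) (by omega)
    refine Or.inr (Or.inl ⟨Nat.pos_of_ne_zero hz, ?_⟩)
    by_contra hd
    have hc := hM _ hd
    rw [← hl, Multiset.coe_count] at hc
    have h1 : r + 1 < l.length := by
      have : p (r+1) ≠ 0 := by omega
      exact Finset.mem_range.1 ((hsupp (r+1)).2 this)
    have : 2 ≤ l.count (p r) := by
      rw [← List.duplicate_iff_two_le_count, List.duplicate_iff_exists_distinct_get]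
      refine ⟨⟨r, by omega⟩, ⟨r+1, h1⟩, by simp, ?_, ?_⟩
      · rw [hp, List.getD_eq_getElem _ _ (by omega : r < l.length)]; rfl
      · rw [← heq, hp, List.getD_eq_getElem _ _ h1]; rfl
    omega
  · show (Finset.range l.length).val.map (fun r => l.getD r 0) = M
    rw [← hl, Finset.range_val, Multiset.range, Multiset.map_coe, Multiset.coe_eq_coe]
    apply List.Perm.of_eq
    apply List.ext_getElem
    · simp
    · intro i h1 h2
      simp [h2]

open BPartition in
theorem aux_core1 (h : ℕ) (tau : BPartition) (hc : IsBarCore h tau) : h ∉ partsM tau := by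
  intro hm
  obtain ⟨mu, h1, h2⟩ := aux_exists h ((partsM tau).erase h)
    (fun h' => aux_zero tau (Multiset.mem_of_mem_erase h'))
    (fun x hx => (Multiset.count_le_of_le _ (Multiset.erase_le _ _)).trans
      (aux_count h tau hc.1 x hx))
  exact hc.2 mu ⟨h, h1, Or.inl ⟨rfl, hm, h2⟩⟩

open BPartition in
theorem aux_core2 (h : ℕ) (tau : BPartition) (hc : IsBarCore h tau) (x : ℕ) (hx : h < x)
    (hm : x ∈ partsM tau) : x - h ∈ partsM tau := by
  by_contra hn
  obtain ⟨mu, h1, h2⟩ := aux_exists h ((x-h) ::ₘ (partsM tau).erase x)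
    (by
      intro h'
      rcases Multiset.mem_cons.1 h' with h' | h'
      · omega
      · exact aux_zero tau (Multiset.mem_of_mem_erase h'))
    (by
      intro y hy
      have e : ((partsM tau).erase x).count y ≤ (partsM tau).count y :=
        Multiset.count_le_of_le _ (Multiset.erase_le _ _)
      have e2 := aux_count h tau hc.1 y hy
      rw [Multiset.count_cons]
      split_ifs with hyy
      · have e3 := Multiset.count_eq_zero_of_notMem hn
        rw [← hyy] at e3
        omega
      · omega)
  exact hc.2 mu ⟨x, h1, Or.inr (Or.inl ⟨hx, hm, h2⟩)⟩

open BPartition in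
theorem aux_core3 (n h : ℕ) (hh : h = 2 * n + 1) (tau : BPartition) (hc : IsBarCore h tau)
    (x y : ℕ) (hxy : x + y = h)
    (hx : x ∈ partsM tau) (hy : y ∈ partsM tau) : False := by
  obtain ⟨mu, h1, h2⟩ := aux_exists h (((partsM tau).erase x).erase y)
    (fun h' => aux_zero tau (Multiset.mem_of_mem_erase (Multiset.mem_of_mem_erase h')))
    (fun z hz => (Multiset.count_le_of_le _ ((Multiset.erase_le _ _).trans
      (Multiset.erase_le _ _))).trans (aux_count h tau hc.1 z hz))
  exact hc.2 mu ⟨_, h1, Or.inr (Or.inr ⟨x, y, hxy, hx,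
    (Multiset.mem_erase_of_ne (by omega)).2 hy, rfl, h2⟩)⟩

open BPartition in
theorem aux_big (h : ℕ) (l m : BPartition) (v : ℕ) (hv : h < v) (hs : barStepRec h l m v) :
    ∃ E, partsM l = v ::ₘ E ∧ partsM m = (v - h) ::ₘ E := by
  rcases hs.2 with ⟨h1, _⟩ | ⟨_, h1, h2⟩ | ⟨a, b, h1, _, _, h2, _⟩
  · omega
  · exact ⟨_, (Multiset.cons_erase h1).symm, h2⟩
  · omega

open BPartition in
theorem aux_small (n h : ℕ) (hh : h = 2 * n + 1) (l m : BPartition) (v : ℕ) (hv : v < h)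
    (hs : barStepRec h l m v) :
    n < v ∧ partsM l = v ::ₘ (h - v) ::ₘ partsM m := by
  rcases hs.2 with ⟨h1, _⟩ | ⟨_, h1, h2⟩ | ⟨a, b, h1, h2, h3, h4, h5⟩
  · omega
  · omega
  · have e : partsM l = a ::ₘ b ::ₘ partsM m := by
      rw [h5, Multiset.cons_erase h3, Multiset.cons_erase h2]
    refine ⟨by omega, ?_⟩
    rcases le_total a b with hab | hab
    · rw [max_eq_right hab] at h4
      rw [e, h4, Multiset.cons_swap, show h - b = a by omega]
    · rw [max_eq_left hab] at h4
      rw [e, h4, show h - a = b by omega]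

open BPartition in
theorem aux_struct (n h : ℕ) (hh : h = 2 * n + 1) (tau lam : BPartition) (a b : ℕ)
    (ha : a < h) (hb' : h < b) (hb : BarPositions h tau lam a b) :
    n < a ∧ (b - h) ::ₘ partsM lam = b ::ₘ a ::ₘ (h - a) ::ₘ partsM tau := by
  obtain ⟨_, nu, v1, v2, s1, s2, he⟩ := hb
  have : (a = v1 ∧ b = v2) ∨ (a = v2 ∧ b = v1) := by
    have he' : a ::ₘ {b} = v1 ::ₘ ({v2} : Multiset ℕ) := he
    rw [Multiset.cons_eq_cons] at he'
    rcases he' with ⟨e1, e2⟩ | ⟨_, cs, e1, e2⟩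
    · left; exact ⟨e1, by simpa using e2⟩
    · right
      have e3 : b = v1 ∧ cs = 0 := by
        have := congrArg Multiset.card e1
        simp at this
        subst this
        simpa using e1
      obtain ⟨e3, rfl⟩ := e3
      exact ⟨by simpa using e2.symm, e3⟩
  rcases this with ⟨rfl, rfl⟩ | ⟨rfl, rfl⟩
  · obtain ⟨hn, e1⟩ := aux_small n h hh _ _ _ ha s1
    obtain ⟨E, e2, e3⟩ := aux_big h _ _ _ hb' s2
    refine ⟨hn, ?_⟩
    rw [e1, e2, e3]
    simp only [← Multiset.singleton_add]
    abel
  · obtain ⟨hn, e1⟩ := aux_small n h hh _ _ _ ha s2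
    obtain ⟨E, e2, e3⟩ := aux_big h _ _ _ hb' s1
    refine ⟨hn, ?_⟩
    rw [← e1, e2, e3, Multiset.cons_swap]

open BPartition in
/-- If λ ∈ P_{τ,2} has ∂λ = 0 and a 2h-bar, then a(λ) ≥ h. -/
theorem stmt13 (n h : ℕ) (hn : 1 ≤ n) (hh : h = 2 * n + 1)
    (tau lam : BPartition) (h1 : InBlock h tau 2 lam)
    (a b : ℕ) (hb : BarPositions h tau lam a b)
    (hd : ddd h tau lam a b = 0) (h2h : b = a + h ∨ a + b = 2 * h) :
    h ≤ a := by
  by_contra hlt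
  push Not at hlt
  obtain ⟨hls, hcore, _⟩ := h1
  have ha0 : 0 < a := by
    rcases Nat.eq_zero_or_pos a with h0 | h0
    · exfalso
      obtain ⟨_, nu, v1, v2, s1, s2, he⟩ := hb
      have hm : a ∈ ({v1, v2} : Multiset ℕ) := he ▸ (by simp)
      simp only [Multiset.insert_eq_cons, Multiset.mem_cons, Multiset.mem_singleton] at hm
      rcases hm with rfl | rfl
      · have := (aux_small n h hh _ _ _ hlt s1).1; omega
      · have := (aux_small n h hh _ _ _ hlt s2).1; omega
    · exact h0
  have hbh : h < b := by omega
  obtain ⟨hna, hst⟩ := aux_struct n h hh tau lam a b hlt hbh hb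
  have c1 := aux_core1 h tau hcore
  have c2 := aux_core2 h tau hcore
  have c3 := aux_core3 n h hh tau hcore
  have c0 := aux_zero tau
  have hbb : (b = a + h ∧ partsM lam = b ::ₘ (h - a) ::ₘ partsM tau) ∨
      (a + b = 2 * h ∧ partsM lam = b ::ₘ a ::ₘ partsM tau) := by
    rcases h2h with e | e
    · left
      refine ⟨e, ?_⟩
      rw [show b - h = a by omega, Multiset.cons_swap b a] at hst
      exact (Multiset.cons_inj_right _).1 hst
    · right
      refine ⟨e, ?_⟩
      rw [show b - h = h - a by omega, Multiset.cons_swap a, Multiset.cons_swap b] at hst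
      exact (Multiset.cons_inj_right _).1 hst
  have hsub : ∀ x ∈ partsM tau, x ∈ partsM lam := by
    intro x hx
    rcases hbb with ⟨_, e⟩ | ⟨_, e⟩ <;> rw [e] <;> simp [hx]
  have hndvd : ∀ c, 0 < c → c < h → ¬ h ∣ c := fun c h0 h1 h2 =>
    absurd (Nat.le_of_dvd h0 h2) (by omega)
  have hcnt : ∀ c, 0 < c → c < h → partsM lam = b ::ₘ c ::ₘ partsM tau → c ∉ partsM tau := by
    intro c h0 h1 e hm
    have h2 := aux_count h lam hls c (hndvd c h0 h1)
    rw [e, Multiset.count_cons_of_ne (by omega), Multiset.count_cons_self] at h2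
    have := Multiset.one_le_count_iff_mem.2 hm
    omega
  have hleg : legLen h tau lam a = legLen h tau lam b := by
    unfold ddd at hd
    omega
  unfold legLen at hleg
  rw [if_neg (by omega), if_pos hbh.le] at hleg
  set A := (Finset.Ioo (h-a) a).filter (fun x => x ∈ partsM lam ∧ x ∈ partsM tau) with hA
  set B := (Finset.Ioo (b-h) b).filter (fun x => x ∈ partsM lam ∧ x ∈ partsM tau) with hB
  have eA : {x : ℕ | h - a < x ∧ x < a ∧ x ∈ partsM lam ∧ x ∈ partsM tau} = (A : Set ℕ) := by
    ext x; simp [hA, and_assoc]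
  have eB : {x : ℕ | b - h < x ∧ x < b ∧ x ∈ partsM lam ∧ x ∈ partsM tau} = (B : Set ℕ) := by
    ext x; simp [hB, and_assoc]
  rw [eA, eB, Set.ncard_coe_finset, Set.ncard_coe_finset] at hleg
  have hcard : B.card ≤ (Finset.Ioo 0 (h-a) ∪ A).card := by
    apply Finset.card_le_card_of_injOn
      (fun x => if x < a then x else if x < h then h - x else x - h)
    · intro x hx
      simp only [hB, Finset.coe_filter, Finset.mem_Ioo, Set.mem_setOf_eq] at hx
      obtain ⟨⟨x1, x2⟩, x3, x4⟩ := hx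
      have xh : x ≠ h := fun e => c1 (e ▸ x4)
      simp only [Finset.coe_union, Set.mem_union, Finset.mem_coe, hA, Finset.mem_filter,
        Finset.mem_Ioo]
      split_ifs with i1 i2
      · right
        refine ⟨⟨?_, i1⟩, x3, x4⟩
        rcases hbb with ⟨e, _⟩ | ⟨e, _⟩ <;> omega
      · left
        have : x ≠ a := by
          rcases hbb with ⟨e, _⟩ | ⟨e, e'⟩
          · omega
          · intro hxa
            exact hcnt a ha0 hlt e' (hxa ▸ x4)
        omega
      · have x5 := c2 x (by omega) x4
        by_cases i3 : x - h < h - a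
        · left; omega
        · right
          rcases hbb with ⟨e, e'⟩ | ⟨e, e'⟩
          · have : x - h ≠ h - a := fun hxa => hcnt (h-a) (by omega) (by omega) e' (hxa ▸ x5)
            exact ⟨by omega, hsub _ x5, x5⟩
          · omega
    · intro x hx y hy hxy
      simp only [hB, Finset.coe_filter, Finset.mem_Ioo, Set.mem_setOf_eq] at hx hy
      obtain ⟨⟨x1, x2⟩, x3, x4⟩ := hx
      obtain ⟨⟨y1, y2⟩, y3, y4⟩ := hy
      have xh : x ≠ h := fun e => c1 (e ▸ x4)
      have yh : y ≠ h := fun e => c1 (e ▸ y4)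
      have key1 : h < x → y < h → (x - h) + y ≠ h := fun i j e => c3 _ _ e (c2 x i x4) y4
      have key2 : h < y → x < h → (y - h) + x ≠ h := fun i j e => c3 _ _ e (c2 y i y4) x4
      have key3 : x + y ≠ h := fun e => c3 _ _ e x4 y4
      dsimp only at hxy
      rcases hbb with ⟨e, _⟩ | ⟨e, _⟩ <;> split_ifs at hxy <;> omega
  have := Finset.card_union_le (Finset.Ioo 0 (h-a)) A
  rw [Nat.card_Ioo] at this
  omega
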